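/- There exist a constant δ ∈ (0,1) and an absolute constant C such that the following holds. Let d = (d_1,…,d_n) be a degree sequence with m = (∑_v d_v)/2 an integer and max_v d_v < √m / 2, and let G be drawn from ECM(d) with MinBucket buckets formed. Then for every vertex v, E[X_v(X_v − 1)] ≤ C·( exp(−δ d_v)·d_v² + m^{−2}·d_v²·∑_{w : d_w ≥ δ d_v} ∑_{w′ ≠ w : d_{w′} ≥ δ d_v} d_w d_{w′} ). -/

import Mathlib

open Finset

noncomputable section
attribute [local instance] Classical.propDecidable

/-- The perfect matchings of the stub set `Fin N`: fixed-point-free involutions. -/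
def matchings (N : ℕ) : Finset (Equiv.Perm (Fin N)) :=
  Finset.univ.filter fun M => ∀ s, M (M s) = s ∧ M s ≠ s

/-- `φ` is a stub map for the degree sequence `d`: vertex `v` owns exactly `d v` stubs. -/
def IsStubMap {n N : ℕ} (d : Fin n → ℕ) (φ : Fin N → Fin n) : Prop :=
  ∀ v, (Finset.univ.filter fun s => φ s = v).card = d v

/-- Adjacency in the erased (simple) graph: distinct vertices joined by a matched stub pair. -/
def ecmAdj {n N : ℕ} (φ : Fin N → Fin n) (M : Equiv.Perm (Fin N)) (u v : Fin n) : Prop :=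
  u ≠ v ∧ ∃ s, φ s = u ∧ φ (M s) = v

/-- The degree `D_v` of vertex `v` in the erased graph. -/
def ecmDeg {n N : ℕ} (φ : Fin N → Fin n) (M : Equiv.Perm (Fin N)) (v : Fin n) : ℕ :=
  (Finset.univ.filter fun u => ecmAdj φ M u v).card

/-- The edge `(v,w)` is present and lies in `v`'s bucket:
`(D_v, v) ≤ (D_w, w)` lexicographically. -/
def inBucket {n N : ℕ} (φ : Fin N → Fin n) (M : Equiv.Perm (Fin N)) (v w : Fin n) : Prop :=
  ecmAdj φ M v w ∧
    (ecmDeg φ M v < ecmDeg φ M w ∨ (ecmDeg φ M v = ecmDeg φ M w ∧ v ≤ w))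

/-- Indicator `Y_{v,w}` that the edge `(v,w)` is present and in `v`'s bucket. -/
def ecmY {n N : ℕ} (φ : Fin N → Fin n) (M : Equiv.Perm (Fin N)) (v w : Fin n) : ℝ :=
  if inBucket φ M v w then 1 else 0

/-- `X_v`, the number of edges in `v`'s bucket. -/
def ecmX {n N : ℕ} (φ : Fin N → Fin n) (M : Equiv.Perm (Fin N)) (v : Fin n) : ℝ :=
  ∑ w, ecmY φ M v w

/-- Expectation over the uniformly random perfect matching. -/
def ecmExp (N : ℕ) (g : Equiv.Perm (Fin N) → ℝ) : ℝ :=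
  (∑ M ∈ matchings N, g M) / ((matchings N).card : ℝ)

/-- Probability of an event over the uniformly random perfect matching. -/
def ecmProb (N : ℕ) (A : Equiv.Perm (Fin N) → Prop) : ℝ :=
  (((matchings N).filter A).card : ℝ) / ((matchings N).card : ℝ)

/-- The perfect matchings that agree with `M₀` on the stubs of `A`. -/
def agreeing {N : ℕ} (M₀ : Equiv.Perm (Fin N)) (A : Finset (Fin N)) :
    Finset (Equiv.Perm (Fin N)) :=
  (matchings N).filter fun M => ∀ a ∈ A, M a = M₀ a

/-- The stubs covered by the edges of `M₀` at the stubs of `A`. -/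
def exposed {N : ℕ} (M₀ : Equiv.Perm (Fin N)) (A : Finset (Fin N)) : Finset (Fin N) :=
  A ∪ A.image M₀

/-- The stubs belonging to vertex `v`. -/
def stubs {n N : ℕ} (φ : Fin N → Fin n) (v : Fin n) : Finset (Fin N) :=
  Finset.univ.filter fun s => φ s = v

/-- The vertices other than `v` hit by the partners under `M₀` of the stubs of `A`. -/
def hit {n N : ℕ} (φ : Fin N → Fin n) (v : Fin n) (M₀ : Equiv.Perm (Fin N))
    (A : Finset (Fin N)) : Finset (Fin n) :=
  (A.image fun a => φ (M₀ a)).erase v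

lemma mem_matchings {N : ℕ} {M : Equiv.Perm (Fin N)} :
    M ∈ matchings N ↔ ∀ s, M (M s) = s ∧ M s ≠ s := by
  simp [matchings]

lemma mem_agreeing {N : ℕ} {M M₀ : Equiv.Perm (Fin N)} {A : Finset (Fin N)} :
    M ∈ agreeing M₀ A ↔ M ∈ matchings N ∧ ∀ a ∈ A, M a = M₀ a := by
  simp [agreeing]

lemma mem_exposed {N : ℕ} {M₀ : Equiv.Perm (Fin N)} {A : Finset (Fin N)} {s : Fin N} :
    s ∈ exposed M₀ A ↔ s ∈ A ∨ ∃ a ∈ A, M₀ a = s := by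
  simp [exposed]

lemma card_exposed_le {N : ℕ} (M₀ : Equiv.Perm (Fin N)) (A : Finset (Fin N)) :
    (exposed M₀ A).card ≤ 2 * A.card := by
  have h1 := Finset.card_union_le A (A.image M₀)
  have h2 := Finset.card_image_le (s := A) (f := M₀)
  unfold exposed
  omega

/-- Relabelling `t` as `t'` maps the matchings with `M s = t` into those with `M s = t'`. -/
lemma card_agreeing_partner_le {N : ℕ} {M₀ : Equiv.Perm (Fin N)} {A : Finset (Fin N)}
    {s t t' : Fin N}
    (ht : t ∉ insert s (exposed M₀ A)) (ht' : t' ∉ insert s (exposed M₀ A)) :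
    ((agreeing M₀ A).filter fun M => M s = t).card ≤
      ((agreeing M₀ A).filter fun M => M s = t').card := by
  simp only [Finset.mem_insert, not_or] at ht ht'
  have hfix : ∀ u, u = s ∨ u ∈ exposed M₀ A → Equiv.swap t t' u = u := by
    intro u hu
    apply Equiv.swap_apply_of_ne_of_ne
    · rintro rfl; tauto
    · rintro rfl; tauto
  apply Finset.card_le_card_of_injOn
    (fun M => Equiv.swap t t' * M * Equiv.swap t t')
  · intro M hM
    simp only [Finset.coe_filter, Set.mem_ofPred_eq, mem_agreeing, mem_matchings] at hM ⊢
    obtain ⟨⟨hM, hA⟩, hst⟩ := hM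
    refine ⟨⟨fun u => ⟨?_, ?_⟩, fun a ha => ?_⟩, ?_⟩
    · simp [Equiv.Perm.mul_apply, (hM _).1]
    · simp only [Equiv.Perm.mul_apply]
      intro h
      have h2 := congrArg (Equiv.swap t t') h
      rw [Equiv.swap_apply_self] at h2
      exact (hM _).2 h2
    · simp only [Equiv.Perm.mul_apply]
      rw [hfix a (Or.inr (mem_exposed.2 (Or.inl ha))), hA a ha]
      exact hfix _ (Or.inr (mem_exposed.2 (Or.inr ⟨a, ha, rfl⟩)))
    · simp only [Equiv.Perm.mul_apply]
      rw [hfix s (Or.inl rfl), hst, Equiv.swap_apply_left]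
  · intro M _ M' _ h
    simpa using h

/-- Given the partners of the stubs of `A`, an unexposed stub `s` has any given partner with
probability at most `1 / (N - |exposed| - 1)`. -/
lemma card_partner_mul_le {N : ℕ} {M₀ : Equiv.Perm (Fin N)} {A : Finset (Fin N)}
    {s : Fin N} (hs : s ∉ exposed M₀ A) (t : Fin N) :
    (N - ((exposed M₀ A).card + 1)) * ((agreeing M₀ A).filter fun M => M s = t).card ≤
      (agreeing M₀ A).card := by
  by_cases ht : t ∈ insert s (exposed M₀ A)
  · have : ((agreeing M₀ A).filter fun M => M s = t) = ∅ := by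
      rw [Finset.filter_eq_empty_iff]
      intro M hM hst
      rw [mem_agreeing, mem_matchings] at hM
      obtain ⟨hM, hA⟩ := hM
      rw [Finset.mem_insert, mem_exposed] at ht
      rcases ht with rfl | ht | ⟨a, ha, hat⟩
      · exact (hM t).2 hst
      · apply hs
        rw [mem_exposed]
        refine Or.inr ⟨t, ht, ?_⟩
        rw [← hA t ht, ← hst, (hM s).1]
      · apply hs
        rw [mem_exposed]
        left
        rw [← hA a ha, ← hst] at hat
        rwa [← M.injective hat]
    rw [this]
    simp
  · have hc : ((insert s (exposed M₀ A))ᶜ).card = N - ((exposed M₀ A).card + 1) := by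
      rw [Finset.card_compl, Finset.card_insert_of_notMem hs, Fintype.card_fin]
    rw [← hc, ← smul_eq_mul, ← Finset.sum_const]
    calc _ ≤ ∑ t' ∈ (insert s (exposed M₀ A))ᶜ,
          ((agreeing M₀ A).filter fun M => M s = t').card := by
          apply Finset.sum_le_sum
          intro t' ht'
          exact card_agreeing_partner_le ht (Finset.mem_compl.1 ht')
      _ ≤ ∑ t' : Fin N, ((agreeing M₀ A).filter fun M => M s = t').card :=
          Finset.sum_le_sum_of_subset (Finset.subset_univ _)
      _ = (agreeing M₀ A).card :=
          (Finset.card_eq_sum_card_fiberwise (fun _ _ => by simp)).symm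

lemma filter_agreeing_eq {N : ℕ} {M₀ M₁ : Equiv.Perm (Fin N)} {A : Finset (Fin N)}
    {s t : Fin N} (hM₁ : M₁ ∈ (agreeing M₀ A).filter fun M => M s = t) :
    ((agreeing M₀ A).filter fun M => M s = t) = agreeing M₁ (insert s A) := by
  rw [Finset.mem_filter, mem_agreeing] at hM₁
  obtain ⟨⟨_, hA⟩, hst⟩ := hM₁
  ext M
  simp only [Finset.mem_filter, mem_agreeing, Finset.mem_insert, forall_eq_or_imp, hst]
  constructor
  · rintro ⟨⟨h1, h2⟩, h3⟩
    exact ⟨h1, h3, fun a ha => (h2 a ha).trans (hA a ha).symm⟩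
  · rintro ⟨h1, h3, h2⟩
    exact ⟨⟨h1, fun a ha => (h2 a ha).trans (hA a ha)⟩, h3⟩

lemma card_hit_le_ecmDeg {n N : ℕ} {φ : Fin N → Fin n} {v : Fin n}
    {M M₀ : Equiv.Perm (Fin N)} {A : Finset (Fin N)} (hA : A ⊆ stubs φ v)
    (hM : M ∈ agreeing M₀ A) : (hit φ v M₀ A).card ≤ ecmDeg φ M v := by
  rw [mem_agreeing, mem_matchings] at hM
  apply Finset.card_le_card
  intro u hu
  simp only [hit, Finset.mem_erase, Finset.mem_image] at hu
  obtain ⟨huv, a, ha, rfl⟩ := hu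
  have hav : φ a = v := by simpa [stubs] using hA ha
  rw [Finset.mem_filter]
  refine ⟨Finset.mem_univ _, huv, M a, by rw [hM.2 a ha], ?_⟩
  rw [(hM.1 a).1, hav]

lemma card_hit_le {n N : ℕ} (φ : Fin N → Fin n) (v : Fin n)
    (M₀ : Equiv.Perm (Fin N)) (A : Finset (Fin N)) : (hit φ v M₀ A).card ≤ A.card :=
  (Finset.card_erase_le).trans Finset.card_image_le

/-- One exposure step: how the hit set and the unexposed stubs change. -/
lemma exposure_step {n N : ℕ} {φ : Fin N → Fin n} {v : Fin n}
    {M₀ M₁ : Equiv.Perm (Fin N)} {A : Finset (Fin N)} {s : Fin N}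
    (hs : s ∈ stubs φ v) (hA : ∀ a ∈ A, M₁ a = M₀ a) :
    (hit φ v M₀ A).card ≤ (hit φ v M₁ (insert s A)).card ∧
    (stubs φ v \ exposed M₀ A).card ≤ (stubs φ v \ exposed M₁ (insert s A)).card + 2 ∧
    (φ (M₁ s) ∉ insert v (hit φ v M₀ A) →
      (hit φ v M₀ A).card + 1 ≤ (hit φ v M₁ (insert s A)).card ∧
      (stubs φ v \ exposed M₀ A).card ≤
        (stubs φ v \ exposed M₁ (insert s A)).card + 1) := by
  have hsub : hit φ v M₀ A ⊆ hit φ v M₁ (insert s A) := by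
    intro u hu
    simp only [hit, Finset.mem_erase, Finset.mem_image] at hu ⊢
    obtain ⟨huv, a, ha, rfl⟩ := hu
    exact ⟨huv, a, Finset.mem_insert_of_mem ha, by rw [hA a ha]⟩
  have hexp : ∀ u, u ∈ exposed M₁ (insert s A) → u = s ∨ u = M₁ s ∨ u ∈ exposed M₀ A := by
    intro u hu
    rw [mem_exposed] at hu ⊢
    rcases hu with hu | ⟨a, ha, rfl⟩
    · rcases Finset.mem_insert.1 hu with h | h <;> tauto
    · rcases Finset.mem_insert.1 ha with h | h
      · subst h; tauto
      · exact Or.inr (Or.inr (Or.inr ⟨a, h, (hA a h).symm⟩))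
  refine ⟨Finset.card_le_card hsub, ?_, fun ht => ⟨?_, ?_⟩⟩
  · have h1 : stubs φ v \ exposed M₀ A ⊆
        (stubs φ v \ exposed M₁ (insert s A)) ∪ {s, M₁ s} := by
      intro u hu
      have := hexp u
      simp only [Finset.mem_sdiff, Finset.mem_union, Finset.mem_insert,
        Finset.mem_singleton] at hu ⊢
      tauto
    exact (Finset.card_le_card h1).trans ((Finset.card_union_le _ _).trans
      (Nat.add_le_add_left Finset.card_le_two _))
  · rw [Finset.mem_insert, not_or] at ht
    rw [← Finset.card_insert_of_notMem ht.2]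
    apply Finset.card_le_card
    apply Finset.insert_subset _ hsub
    simp only [hit, Finset.mem_erase, Finset.mem_image]
    exact ⟨ht.1, s, Finset.mem_insert_self _ _, rfl⟩
  · have h1 : stubs φ v \ exposed M₀ A ⊆
        (stubs φ v \ exposed M₁ (insert s A)) ∪ {s} := by
      intro u hu
      have h2 := hexp u
      have h3 : u ≠ M₁ s := by
        rintro rfl
        apply ht
        simp only [Finset.mem_sdiff, stubs, Finset.mem_filter] at hu
        simp [hu.1.2]
      simp only [Finset.mem_sdiff, Finset.mem_union, Finset.mem_singleton] at hu ⊢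
      tauto
    exact (Finset.card_le_card h1).trans (Finset.card_union_le _ _)

/-- Conditional exponential moment of the degree of `v` in the erased graph, given the partners
of the stubs of `A`. -/
lemma exp_moment_agreeing {n N : ℕ} {φ : Fin N → Fin n} {v : Fin n}
    (hB : ∀ W : Finset (Fin n), W.card ≤ (stubs φ v).card →
      4 * (Finset.univ.filter fun s => φ s ∈ W).card + 2 * (stubs φ v).card ≤ N)
    (r : ℕ) : ∀ (M₀ : Equiv.Perm (Fin N)) (A : Finset (Fin N)), A ⊆ stubs φ v →
      (stubs φ v \ A).card = r →
      (3 / 2 : ℝ) ^ (stubs φ v \ exposed M₀ A).card *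
          ∑ M ∈ agreeing M₀ A, (1 / 4 : ℝ) ^ ecmDeg φ M v ≤
        (1 / 4 : ℝ) ^ (hit φ v M₀ A).card * (agreeing M₀ A).card := by
  induction r with
  | zero =>
    intro M₀ A hA hr
    have h0 : stubs φ v \ exposed M₀ A = ∅ := by
      rw [Finset.card_eq_zero, Finset.sdiff_eq_empty_iff_subset] at hr
      rw [Finset.sdiff_eq_empty_iff_subset]
      exact hr.trans Finset.subset_union_left
    rw [h0, Finset.card_empty, pow_zero, one_mul, mul_comm, ← nsmul_eq_mul]
    apply Finset.sum_le_card_nsmul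
    intro M hM
    exact pow_le_pow_of_le_one (by norm_num) (by norm_num) (card_hit_le_ecmDeg hA hM)
  | succ r ih =>
    intro M₀ A hA hr
    rcases Finset.eq_empty_or_nonempty (stubs φ v \ exposed M₀ A) with h0 | ⟨s, hsU⟩
    · rw [h0, Finset.card_empty, pow_zero, one_mul, mul_comm, ← nsmul_eq_mul]
      apply Finset.sum_le_card_nsmul
      intro M hM
      exact pow_le_pow_of_le_one (by norm_num) (by norm_num) (card_hit_le_ecmDeg hA hM)
    · rw [Finset.mem_sdiff] at hsU
      obtain ⟨hsS, hsU⟩ := hsU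
      have hsA : s ∉ A := fun h => hsU (mem_exposed.2 (Or.inl h))
      have hA' : insert s A ⊆ stubs φ v := Finset.insert_subset hsS hA
      have hr' : (stubs φ v \ insert s A).card = r := by
        have h1 := Finset.card_sdiff_of_subset hA
        have h2 := Finset.card_sdiff_of_subset hA'
        rw [Finset.card_insert_of_notMem hsA] at h2
        omega
      have hAk : A.card + 1 ≤ (stubs φ v).card := by
        rw [← Finset.card_insert_of_notMem hsA]
        exact Finset.card_le_card hA'
      set h := (hit φ v M₀ A).card with hh
      set c : Fin N → ℝ := fun t => (((agreeing M₀ A).filter fun M => M s = t).card : ℝ) with hc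
      set B := Finset.univ.filter fun t => φ t ∈ insert v (hit φ v M₀ A) with hBdef
      have hc0 : ∀ t, 0 ≤ c t := fun t => Nat.cast_nonneg _
      have hcsum : ∑ t, c t = ((agreeing M₀ A).card : ℝ) := by
        rw [Finset.card_eq_sum_card_fiberwise (f := fun M => M s) (t := Finset.univ)
          (fun _ _ => by simp)]
        push_cast
        rfl
      have hBc : 4 * ∑ t ∈ B, c t ≤ ((agreeing M₀ A).card : ℝ) := by
        have hW := hB (insert v (hit φ v M₀ A)) (by
          have h1 := Finset.card_insert_le v (hit φ v M₀ A)
          have h2 := card_hit_le φ v M₀ A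
          omega)
        have hU := card_exposed_le M₀ A
        have hB' : 4 * B.card ≤ N - ((exposed M₀ A).card + 1) := by
          change 4 * B.card + _ ≤ N at hW
          omega
        rcases B.eq_empty_or_nonempty with hBe | hBn
        · rw [hBe]; simp
        · have hpt : ∀ t ∈ B, 4 * c t ≤ (B.card : ℝ)⁻¹ * ((agreeing M₀ A).card : ℝ) := by
            intro t _
            have h1 := (Nat.mul_le_mul_right _ hB').trans (card_partner_mul_le hsU t)
            have h2 : (4 * (B.card : ℝ)) * c t ≤ ((agreeing M₀ A).card : ℝ) := by
              simp only [hc]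
              exact_mod_cast h1
            have hBpos : (0 : ℝ) < B.card := by exact_mod_cast hBn.card_pos
            rw [inv_mul_eq_div, le_div_iff₀ hBpos]
            linarith
          have hBpos : (B.card : ℝ) ≠ 0 := by exact_mod_cast hBn.card_pos.ne'
          rw [Finset.mul_sum]
          refine (Finset.sum_le_card_nsmul _ _ _ hpt).trans ?_
          rw [nsmul_eq_mul, mul_inv_cancel_left₀ hBpos]
      have hclass : ∀ t, (3 / 2 : ℝ) ^ (stubs φ v \ exposed M₀ A).card *
          ∑ M ∈ (agreeing M₀ A).filter (fun M => M s = t), (1 / 4 : ℝ) ^ ecmDeg φ M v ≤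
          (1 / 4 : ℝ) ^ h * ((if t ∈ B then 9 / 4 * c t else 0) + 3 / 8 * c t) := by
        intro t
        rcases ((agreeing M₀ A).filter fun M => M s = t).eq_empty_or_nonempty
          with he | ⟨M₁, hM₁⟩
        · simp only [hc, he]
          simp
        · have heq := filter_agreeing_eq hM₁
          have hih := ih M₁ (insert s A) hA' hr'
          rw [← heq] at hih
          rw [Finset.mem_filter, mem_agreeing] at hM₁
          obtain ⟨⟨_, hM₁A⟩, hst⟩ := hM₁
          obtain ⟨hs1, hs2, hs3⟩ := exposure_step (M₀ := M₀) hsS hM₁A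
          rw [hst] at hs3
          set Z := ∑ M ∈ (agreeing M₀ A).filter (fun M => M s = t),
            (1 / 4 : ℝ) ^ ecmDeg φ M v with hZ
          have hZ0 : 0 ≤ Z := Finset.sum_nonneg fun _ _ => by positivity
          change _ ≤ _ * c t at hih
          have hq : (0 : ℝ) < (1 / 4 : ℝ) ^ h := by positivity
          by_cases htB : t ∈ B
          · rw [if_pos htB]
            calc _ ≤ (3 / 2 : ℝ) ^ ((stubs φ v \ exposed M₁ (insert s A)).card + 2) * Z := by
                  gcongr
                  norm_num
              _ = 9 / 4 * ((3 / 2 : ℝ) ^ (stubs φ v \ exposed M₁ (insert s A)).card * Z) := by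
                  rw [pow_add]; ring
              _ ≤ 9 / 4 * ((1 / 4 : ℝ) ^ (hit φ v M₁ (insert s A)).card * c t) := by gcongr
              _ ≤ 9 / 4 * ((1 / 4 : ℝ) ^ h * c t) := by
                  have := hc0 t
                  have := pow_le_pow_of_le_one (by norm_num : (0 : ℝ) ≤ 1 / 4)
                    (by norm_num) hs1
                  gcongr
              _ ≤ _ := by
                  have := mul_nonneg hq.le (hc0 t)
                  nlinarith
          · rw [if_neg htB]
            obtain ⟨hs4, hs5⟩ := hs3 (by simpa [hBdef] using htB)
            calc _ ≤ (3 / 2 : ℝ) ^ ((stubs φ v \ exposed M₁ (insert s A)).card + 1) * Z := by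
                  gcongr
                  norm_num
              _ = 3 / 2 * ((3 / 2 : ℝ) ^ (stubs φ v \ exposed M₁ (insert s A)).card * Z) := by
                  rw [pow_add]; ring
              _ ≤ 3 / 2 * ((1 / 4 : ℝ) ^ (hit φ v M₁ (insert s A)).card * c t) := by gcongr
              _ ≤ 3 / 2 * ((1 / 4 : ℝ) ^ (h + 1) * c t) := by
                  have := hc0 t
                  have := pow_le_pow_of_le_one (by norm_num : (0 : ℝ) ≤ 1 / 4)
                    (by norm_num) hs4
                  gcongr
              _ = _ := by rw [pow_add]; ring
      rw [← Finset.sum_fiberwise_of_maps_to (g := fun M => M s) (t := Finset.univ)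
        (fun _ _ => by simp), Finset.mul_sum]
      refine (Finset.sum_le_sum fun t _ => hclass t).trans ?_
      rw [← Finset.mul_sum, Finset.sum_add_distrib, ← Finset.mul_sum, hcsum]
      have : ∑ t, (if t ∈ B then 9 / 4 * c t else 0) = 9 / 4 * ∑ t ∈ B, c t := by
        rw [Finset.mul_sum, Finset.sum_ite_mem, Finset.univ_inter]
      rw [this]
      gcongr
      linarith [Nat.cast_nonneg (α := ℝ) (agreeing M₀ A).card]

lemma exp_moment_ecmDeg {n N : ℕ} {φ : Fin N → Fin n} {v : Fin n}
    (hB : ∀ W : Finset (Fin n), W.card ≤ (stubs φ v).card →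
      4 * (Finset.univ.filter fun s => φ s ∈ W).card + 2 * (stubs φ v).card ≤ N) :
    (3 / 2 : ℝ) ^ (stubs φ v).card * ∑ M ∈ matchings N, (1 / 4 : ℝ) ^ ecmDeg φ M v ≤
      (matchings N).card := by
  simpa [exposed, hit, agreeing] using
    exp_moment_agreeing hB _ 1 ∅ (Finset.empty_subset _) rfl

lemma exp_le_of_small_degree {k D : ℕ} (h : (D : ℝ) < 1 / 10 * k) :
    1 ≤ Real.exp (-(1 / 10) * k) * ((3 / 2 : ℝ) ^ k * (1 / 4 : ℝ) ^ D) := by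
  have hD : 10 * D ≤ k := by
    have : (10 * D : ℝ) ≤ k := by linarith
    exact_mod_cast this
  rw [← one_le_pow_iff_of_nonneg (by positivity) (by norm_num : (10 : ℕ) ≠ 0), mul_pow, mul_pow,
    ← Real.exp_nat_mul, ← pow_mul, ← pow_mul, mul_comm k 10, pow_mul, mul_comm D 10]
  have h1 : Real.exp (((10 : ℕ) : ℝ) * (-(1 / 10) * k)) = (Real.exp (-1)) ^ k := by
    rw [← Real.exp_nat_mul]; congr 1; push_cast; ring
  have h2 : (1 / 4 : ℝ) ^ k ≤ (1 / 4 : ℝ) ^ (10 * D) :=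
    pow_le_pow_of_le_one (by norm_num) (by norm_num) hD
  have h3 : (1 / 3 : ℝ) ≤ Real.exp (-1) := by
    rw [Real.exp_neg, one_div]
    exact inv_anti₀ (Real.exp_pos 1) (by linarith [Real.exp_one_lt_d9])
  calc (1 : ℝ) ≤ (1 / 3 * ((3 / 2) ^ 10 * (1 / 4))) ^ k := one_le_pow₀ (by norm_num)
    _ = (1 / 3) ^ k * (((3 / 2) ^ 10) ^ k * (1 / 4) ^ k) := by rw [mul_pow, mul_pow]
    _ ≤ _ := by rw [h1]; gcongr

lemma card_small_degree_le {n N : ℕ} {φ : Fin N → Fin n} {v : Fin n}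
    (hB : ∀ W : Finset (Fin n), W.card ≤ (stubs φ v).card →
      4 * (Finset.univ.filter fun s => φ s ∈ W).card + 2 * (stubs φ v).card ≤ N) :
    ∑ M ∈ matchings N, (if (ecmDeg φ M v : ℝ) < 1 / 10 * (stubs φ v).card then (1 : ℝ) else 0) ≤
      Real.exp (-(1 / 10) * (stubs φ v).card) * (matchings N).card := by
  refine le_trans ?_ (mul_le_mul_of_nonneg_left (exp_moment_ecmDeg hB) (Real.exp_pos _).le)
  rw [Finset.mul_sum, Finset.mul_sum]
  apply Finset.sum_le_sum
  intro M _
  split_ifs with h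
  · exact exp_le_of_small_degree h
  · positivity

/-- Two given disjoint pairs of stubs are both matched with probability at most
`1 / ((N - 1) (N - 3))`. -/
lemma card_two_pairs_mul_le {N : ℕ} {s s' t t' : Fin N} (hss : s' ≠ s) (hst : s' ≠ t) :
    (N - 1) * ((N - 3) * ((matchings N).filter fun M => M s = t ∧ M s' = t').card) ≤
      (matchings N).card := by
  have h0 : agreeing (1 : Equiv.Perm (Fin N)) ∅ = matchings N := by simp [agreeing]
  have hU : exposed (1 : Equiv.Perm (Fin N)) ∅ = ∅ := by simp [exposed]
  have h1 := card_partner_mul_le (M₀ := 1) (A := ∅) (s := s) (by simp [hU]) t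
  rw [hU, h0, Finset.card_empty, zero_add] at h1
  refine le_trans (Nat.mul_le_mul_left _ ?_) h1
  rcases ((matchings N).filter fun M => M s = t).eq_empty_or_nonempty with he | ⟨M₁, hM₁⟩
  · rw [← Finset.filter_filter, he]
    simp
  · have heq : ((matchings N).filter fun M => M s = t) = agreeing M₁ {s} := by
      have := filter_agreeing_eq (M₀ := 1) (A := ∅) (s := s) (t := t) (M₁ := M₁)
        (by rwa [h0])
      rwa [h0] at this
    have hM₁t : M₁ s = t := (Finset.mem_filter.1 hM₁).2
    have hs' : s' ∉ exposed M₁ {s} := by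
      simp [mem_exposed, hss, hM₁t, hst.symm]
    have h2 := card_partner_mul_le hs' t'
    have hcard := card_exposed_le M₁ {s}
    rw [Finset.card_singleton] at hcard
    rw [← Finset.filter_filter, heq]
    exact (Nat.mul_le_mul_right _ (by omega)).trans h2

lemma ecmDeg_le_card_stubs {n N : ℕ} (φ : Fin N → Fin n) (v : Fin n)
    {M : Equiv.Perm (Fin N)} (hM : M ∈ matchings N) : ecmDeg φ M v ≤ (stubs φ v).card := by
  rw [mem_matchings] at hM
  refine le_trans (Finset.card_le_card (t := (stubs φ v).image fun a => φ (M a)) ?_)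
    Finset.card_image_le
  intro u hu
  rw [Finset.mem_filter] at hu
  obtain ⟨_, _, s, hs, hs'⟩ := hu
  rw [Finset.mem_image]
  exact ⟨M s, by simp [stubs, hs'], by rw [(hM s).1, hs]⟩

lemma ecmAdj_symm {n N : ℕ} {φ : Fin N → Fin n} {M : Equiv.Perm (Fin N)}
    (hM : M ∈ matchings N) {u v : Fin n} (h : ecmAdj φ M u v) : ecmAdj φ M v u := by
  rw [mem_matchings] at hM
  obtain ⟨hne, s, hs, hs'⟩ := h
  exact ⟨hne.symm, M s, hs', by rw [(hM s).1, hs]⟩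

lemma ecmX_le {n N : ℕ} (φ : Fin N → Fin n) (v : Fin n)
    {M : Equiv.Perm (Fin N)} (hM : M ∈ matchings N) : ecmX φ M v ≤ (stubs φ v).card := by
  refine le_trans ?_ (Nat.cast_le.2 (ecmDeg_le_card_stubs φ v hM))
  unfold ecmX ecmY ecmDeg
  rw [Finset.sum_boole]
  norm_cast
  apply Finset.card_le_card
  intro w hw
  rw [Finset.mem_filter] at hw ⊢
  exact ⟨hw.1, ecmAdj_symm hM hw.2.1⟩

lemma ecmX_nonneg {n N : ℕ} (φ : Fin N → Fin n) (M : Equiv.Perm (Fin N)) (v : Fin n) :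
    0 ≤ ecmX φ M v :=
  Finset.sum_nonneg fun w _ => by unfold ecmY; split_ifs <;> norm_num

/-- The indicator that `v` is adjacent to both `w` and `w'` is at most the number of pairs of stubs
of `v` matched to stubs of `w` and `w'`, respectively. -/
lemma adj_indicator_le {n N : ℕ} (φ : Fin N → Fin n) (M : Equiv.Perm (Fin N)) (v w w' : Fin n) :
    (if ecmAdj φ M v w ∧ ecmAdj φ M v w' then (1 : ℝ) else 0) ≤
      ∑ p ∈ (stubs φ v ×ˢ stubs φ v) ×ˢ (stubs φ w ×ˢ stubs φ w'),
        if v ≠ w ∧ v ≠ w' ∧ M p.1.1 = p.2.1 ∧ M p.1.2 = p.2.2 then 1 else 0 := by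
  have hnn : ∀ p ∈ (stubs φ v ×ˢ stubs φ v) ×ˢ (stubs φ w ×ˢ stubs φ w'),
      (0 : ℝ) ≤ if v ≠ w ∧ v ≠ w' ∧ M p.1.1 = p.2.1 ∧ M p.1.2 = p.2.2 then 1 else 0 :=
    fun p _ => by split_ifs <;> norm_num
  split_ifs with h
  · obtain ⟨⟨hvw, s, hs, hsw⟩, hvw', s', hs', hsw'⟩ := h
    have hmem : ((s, s'), (M s, M s')) ∈
        (stubs φ v ×ˢ stubs φ v) ×ˢ (stubs φ w ×ˢ stubs φ w') := by
      simp [stubs, *]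
    refine le_trans ?_ (Finset.single_le_sum hnn hmem)
    simp [hvw, hvw']
  · exact Finset.sum_nonneg hnn

lemma sum_adj_indicator_le {n m : ℕ} (hm : 3 ≤ m) (φ : Fin (2 * m) → Fin n)
    (v w w' : Fin n) (hww : w' ≠ w) :
    ∑ M ∈ matchings (2 * m), (if ecmAdj φ M v w ∧ ecmAdj φ M v w' then (1 : ℝ) else 0) ≤
      ((m : ℝ) ^ 2)⁻¹ * ((stubs φ v).card : ℝ) ^ 2 *
        (((stubs φ w).card : ℝ) * (stubs φ w').card) * (matchings (2 * m)).card := by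
  refine (Finset.sum_le_sum fun M _ => adj_indicator_le φ M v w w').trans ?_
  rw [Finset.sum_comm]
  have hpt : ∀ p ∈ (stubs φ v ×ˢ stubs φ v) ×ˢ (stubs φ w ×ˢ stubs φ w'),
      ∑ M ∈ matchings (2 * m),
        (if v ≠ w ∧ v ≠ w' ∧ M p.1.1 = p.2.1 ∧ M p.1.2 = p.2.2 then (1 : ℝ) else 0) ≤
      ((m : ℝ) ^ 2)⁻¹ * (matchings (2 * m)).card := by
    rintro ⟨⟨s, s'⟩, t, t'⟩ hp
    simp only [Finset.mem_product, stubs, Finset.mem_filter, Finset.mem_univ, true_and] at hp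
    obtain ⟨⟨hs, hs'⟩, ht, ht'⟩ := hp
    rw [Finset.sum_boole]
    by_cases hne : v ≠ w ∧ v ≠ w' ∧ s' ≠ s
    · obtain ⟨h1, h2, h3⟩ := hne
      have h4 : s' ≠ t := by rintro rfl; exact h1 (hs'.symm.trans ht)
      have h5 := card_two_pairs_mul_le (t' := t') h3 h4
      simp only [ne_eq, h1, h2, not_false_eq_true, true_and]
      have hmpos : (0 : ℝ) < (m : ℝ) ^ 2 := by positivity
      rw [inv_mul_eq_div, le_div_iff₀ hmpos]
      rw [← mul_assoc] at h5
      have h6 : m ^ 2 ≤ (2 * m - 1) * (2 * m - 3) := by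
        rw [pow_two]
        exact Nat.mul_le_mul (by omega) (by omega)
      have h7 := (Nat.mul_le_mul_right _ h6).trans h5
      rw [mul_comm]
      exact_mod_cast h7
    · have : ((matchings (2 * m)).filter fun M : Equiv.Perm (Fin (2 * m)) =>
          v ≠ w ∧ v ≠ w' ∧ M s = t ∧ M s' = t') = ∅ := by
        rw [Finset.filter_eq_empty_iff]
        rintro M _ ⟨h1, h2, h3, h4⟩
        apply hne
        refine ⟨h1, h2, ?_⟩
        rintro rfl
        apply hww
        rw [← ht, ← ht', ← h3, ← h4]
      simp only [this]
      simp only [Finset.card_empty, Nat.cast_zero]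
      positivity
  refine (Finset.sum_le_card_nsmul _ _ _ hpt).trans (le_of_eq ?_)
  rw [nsmul_eq_mul, Finset.card_product, Finset.card_product, Finset.card_product]
  push_cast
  ring

lemma ecmX_wedge_le {n N : ℕ} (φ : Fin N → Fin n) (v : Fin n) (δ : ℝ)
    {M : Equiv.Perm (Fin N)} (hM : M ∈ matchings N) (L : Finset (Fin n))
    (hL : ∀ w, δ * ((stubs φ v).card : ℝ) ≤ ((stubs φ w).card : ℝ) → w ∈ L) :
    ecmX φ M v * (ecmX φ M v - 1) ≤
      ((stubs φ v).card : ℝ) ^ 2 *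
        (if (ecmDeg φ M v : ℝ) < δ * (stubs φ v).card then (1 : ℝ) else 0) +
      ∑ w ∈ L, ∑ w' ∈ L.erase w,
        (if ecmAdj φ M v w ∧ ecmAdj φ M v w' then (1 : ℝ) else 0) := by
  have hX0 := ecmX_nonneg φ M v
  have hX1 := ecmX_le φ v hM
  have hsum : 0 ≤ ∑ w ∈ L, ∑ w' ∈ L.erase w,
      (if ecmAdj φ M v w ∧ ecmAdj φ M v w' then (1 : ℝ) else 0) :=
    Finset.sum_nonneg fun _ _ => Finset.sum_nonneg fun _ _ => by split_ifs <;> norm_num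
  by_cases hD : (ecmDeg φ M v : ℝ) < δ * (stubs φ v).card
  · rw [if_pos hD]
    nlinarith
  · rw [if_neg hD, mul_zero, zero_add]
    have hY : ∀ w, w ∉ L → ecmY φ M v w = 0 := by
      intro w hw
      unfold ecmY
      rw [if_neg]
      rintro ⟨_, h⟩
      apply hw
      apply hL
      have h1 : ecmDeg φ M v ≤ ecmDeg φ M w := by omega
      have h2 : (ecmDeg φ M v : ℝ) ≤ (stubs φ w).card := by
        exact_mod_cast h1.trans (ecmDeg_le_card_stubs φ w hM)
      linarith
    have hYsq : ∀ w, ecmY φ M v w * ecmY φ M v w = ecmY φ M v w := by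
      intro w; unfold ecmY; split_ifs <;> norm_num
    have hX : ecmX φ M v = ∑ w ∈ L, ecmY φ M v w :=
      (Finset.sum_subset (Finset.subset_univ L) fun w _ hw => hY w hw).symm
    rw [mul_sub, mul_one, hX, Finset.sum_mul_sum, ← Finset.sum_sub_distrib]
    apply Finset.sum_le_sum
    intro w hw
    rw [← Finset.add_sum_erase L _ hw, hYsq, add_sub_cancel_left]
    apply Finset.sum_le_sum
    intro w' _
    unfold ecmY
    by_cases h1 : inBucket φ M v w
    · by_cases h2 : inBucket φ M v w'
      · rw [if_pos h1, if_pos h2, if_pos ⟨h1.1, h2.1⟩, mul_one]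
      · rw [if_neg h2, mul_zero]; split_ifs <;> norm_num
    · rw [if_neg h1, zero_mul]; split_ifs <;> norm_num

/-- If all degrees are below `√m / 2`, few stubs belong to any `d v` vertices. -/
lemma card_stubs_of_few_vertices {n m : ℕ} {d : Fin n → ℕ} {φ : Fin (2 * m) → Fin n}
    (hm : 1 ≤ m) (hd : ∀ v, (d v : ℝ) < Real.sqrt m / 2) (hφ : ∀ v, (stubs φ v).card = d v)
    (v : Fin n) (W : Finset (Fin n)) (hW : W.card ≤ (stubs φ v).card) :
    4 * (Finset.univ.filter fun s => φ s ∈ W).card + 2 * (stubs φ v).card ≤ 2 * m := by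
  have hcard : (Finset.univ.filter fun s => φ s ∈ W).card = ∑ u ∈ W, d u := by
    rw [Finset.card_eq_sum_card_fiberwise (f := φ) (t := W) (fun s hs => by simpa using hs)]
    apply Finset.sum_congr rfl
    intro u hu
    rw [← hφ u, stubs, Finset.filter_filter]
    congr 1
    ext s
    simp only [Finset.mem_filter, Finset.mem_univ, true_and, and_iff_right_iff_imp]
    rintro rfl
    exact hu
  have hsq : Real.sqrt m * Real.sqrt m = m := Real.mul_self_sqrt (Nat.cast_nonneg m)
  have hs1 : (1 : ℝ) ≤ Real.sqrt m := Real.one_le_sqrt.2 (by exact_mod_cast hm)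
  have h1 : (∑ u ∈ W, d u : ℝ) ≤ W.card * (Real.sqrt m / 2) := by
    rw [← nsmul_eq_mul]
    exact Finset.sum_le_card_nsmul _ _ _ fun u _ => (hd u).le
  have h2 : (W.card : ℝ) ≤ Real.sqrt m / 2 :=
    (Nat.cast_le.2 (hW.trans (hφ v).le)).trans (hd v).le
  have h3 := hd v
  rw [hcard, hφ]
  have : (4 * (∑ u ∈ W, d u : ℝ) + 2 * d v) ≤ 2 * m := by nlinarith
  exact_mod_cast this

/-- There exist a constant `δ ∈ (0,1)` and an absolute constant `C` such
that for every degree sequence `d` with `∑ d_v = 2m` and `max d_v < √m / 2`, and every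
vertex `v`, over `ECM(d)`:
`E[X_v (X_v - 1)] ≤ C (exp(-δ d_v) d_v² + m⁻² d_v² ∑_{w : d_w ≥ δ d_v} ∑_{w' ≠ w : d_{w'} ≥ δ d_v} d_w d_{w'})`. -/
theorem ecm_bucket_wedge_bound :
    ∃ δ : ℝ, δ ∈ Set.Ioo (0 : ℝ) 1 ∧ ∃ C : ℝ,
      ∀ (n m : ℕ) (d : Fin n → ℕ) (φ : Fin (2 * m) → Fin n),
        (∀ v, 0 < d v) →
        (∑ v, d v) = 2 * m →
        (∀ v, (d v : ℝ) < Real.sqrt m / 2) →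
        IsStubMap d φ →
        ∀ v : Fin n,
          ecmExp (2 * m) (fun M => ecmX φ M v * (ecmX φ M v - 1)) ≤
            C * (Real.exp (-δ * d v) * (d v : ℝ) ^ 2 +
              ((m : ℝ) ^ 2)⁻¹ * (d v : ℝ) ^ 2 *
                ∑ w ∈ Finset.univ.filter (fun w => δ * (d v : ℝ) ≤ (d w : ℝ)),
                  ∑ w' ∈ (Finset.univ.filter
                      (fun w' => δ * (d v : ℝ) ≤ (d w' : ℝ))).erase w,
                    (d w : ℝ) * (d w' : ℝ)) := by
  refine ⟨1 / 10, by norm_num, 1, ?_⟩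
  intro n m d φ hpos _ hd hstub v
  have hφ : ∀ u, (stubs φ u).card = d u := hstub
  have hm : 3 ≤ m := by
    have h1 : (1 : ℝ) ≤ d v := by exact_mod_cast hpos v
    have h2 : (2 : ℝ) < Real.sqrt m := by linarith [hd v]
    have h3 : (4 : ℝ) < m := by
      nlinarith [Real.mul_self_sqrt (Nat.cast_nonneg (α := ℝ) m)]
    have h4 : 4 < m := by exact_mod_cast h3
    omega
  set L := Finset.univ.filter fun w => (1 / 10 : ℝ) * (d v : ℝ) ≤ (d w : ℝ) with hLdef
  have hsmall := card_small_degree_le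
    (card_stubs_of_few_vertices (by omega) hd hφ v)
  have hL : ∀ w, (1 / 10 : ℝ) * ((stubs φ v).card : ℝ) ≤ ((stubs φ w).card : ℝ) → w ∈ L := by
    intro w hw
    rw [hφ, hφ] at hw
    simpa [hLdef] using hw
  unfold ecmExp
  apply div_le_of_le_mul₀ (Nat.cast_nonneg _)
  · positivity
  refine (Finset.sum_le_sum fun M hM => ecmX_wedge_le φ v (1 / 10) hM L hL).trans ?_
  rw [Finset.sum_add_distrib, ← Finset.mul_sum, one_mul, add_mul]
  apply add_le_add
  · rw [hφ v] at hsmall ⊢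
    refine (mul_le_mul_of_nonneg_left hsmall (by positivity)).trans (le_of_eq ?_)
    ring
  · rw [Finset.sum_comm, Finset.mul_sum, Finset.sum_mul]
    apply Finset.sum_le_sum
    intro w _
    rw [Finset.sum_comm, Finset.mul_sum, Finset.sum_mul]
    apply Finset.sum_le_sum
    intro w' hw'
    have h := sum_adj_indicator_le hm φ v w w' (Finset.ne_of_mem_erase hw')
    rwa [hφ, hφ, hφ] at h
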